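/- arXiv:1806.03421 — 2 statements merged into one kernel-verified Lean document; each statement's English description precedes it below -/
import Mathlib

section
/- Let 0 < α < 1 and for integers n ≥ 2 define γ_{n−1}^{(α)} = ((n − 2α)/(1 + α − n)) (−1)^{n−2} C(α−2, n−2) + (n − α/2)^{1−α}/Γ(2−α). There exists a constant C > 0 such that for every integer n ≥ 2, |γ_{n−1}^{(α)} − (26 − α)/(24 Γ(−α) n^{1+α})| ≤ C / n^{2+α}. -/
open Finset

/-- Generalized binomial coefficient `C(a,k) = a(a-1)⋯(a-k+1)/k!`. -/
noncomputable def genBinom (a : ℝ) : ℕ → ℝ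
  | 0 => 1
  | k + 1 => genBinom a k * (a - k) / (k + 1)

open Filter Topology Asymptotics

theorem log_one_add_mul_sub_isBigO (a : ℝ) :
    (fun x : ℝ => Real.log (1 + a * x) - (a * x - (a * x) ^ 2 / 2 + (a * x) ^ 3 / 3))
      =O[𝓝 0] fun x => x ^ 4 := by
  have h : ∀ᶠ x : ℝ in 𝓝 0, |a * x| < 1 / 2 := by
    have : Tendsto (fun x : ℝ => |a * x|) (𝓝 0) (𝓝 0) := by
      have : Continuous fun x : ℝ => |a * x| := by fun_prop
      simpa using this.tendsto 0
    exact this.eventually (gt_mem_nhds (by norm_num))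
  refine IsBigO.of_bound (2 * |a| ^ 4) ?_
  filter_upwards [h] with x hx
  have h1 := Real.abs_log_sub_add_sum_range_le (x := -(a * x)) (by rw [abs_neg]; linarith) 3
  simp only [Finset.sum_range_succ, Finset.sum_range_zero, abs_neg] at h1
  norm_num at h1
  rw [Real.norm_eq_abs, Real.norm_eq_abs]
  calc _ = |-(a * x) + (a * x) ^ 2 / 2 + (-(a * x)) ^ 3 / 3 + Real.log (1 + a * x)| := by
        congr 1; ring
    _ ≤ (|a| * |x|) ^ 4 / (1 - |a| * |x|) := h1
    _ ≤ (|a| * |x|) ^ 4 / (1 / 2) := by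
        rw [abs_mul] at hx
        gcongr
        linarith
    _ = _ := by rw [abs_pow]; ring

theorem log_increment_isBigO (α : ℝ) :
    (fun x : ℝ => Real.log (1 + (1 - α) / 2 * x) - Real.log (1 + (1 + α) / 2 * x)
        + α * Real.log (1 + 1 * x)
        + α * (1 - α ^ 2) / 24 * (x ^ 2 / (1 + x) ^ 2 - x ^ 2))
      =O[𝓝 0] fun x => x ^ 4 := by
  have h4 : (fun x : ℝ => α * (1 - α ^ 2) / 24 * (x ^ 2 / (1 + x) ^ 2 - x ^ 2 + 2 * x ^ 3))
      =O[𝓝 0] fun x => x ^ 4 := by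
    apply IsBigO.const_mul_left
    have hc : ContinuousAt (fun x : ℝ => (3 + 2 * x) / (1 + x) ^ 2) 0 := by
      apply ContinuousAt.div <;> first | fun_prop | norm_num
    have := (hc.tendsto.isBigO_one ℝ).mul (isBigO_refl (fun x : ℝ => x ^ 4) (𝓝 0))
    simp only [one_mul] at this
    refine this.congr' ?_ .rfl
    have : ∀ᶠ x : ℝ in 𝓝 0, -1 < x := lt_mem_nhds (by norm_num)
    filter_upwards [this] with x hx
    have : 1 + x ≠ 0 := by linarith
    field_simp
    ring
  refine ((((log_one_add_mul_sub_isBigO ((1 - α) / 2)).sub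
    (log_one_add_mul_sub_isBigO ((1 + α) / 2))).add
    ((log_one_add_mul_sub_isBigO 1).const_mul_left α)).add h4).congr_left fun x => ?_
  ring

theorem pow_isBigO_pow_nhds_zero {m n : ℕ} (h : m ≤ n) :
    (fun x : ℝ => x ^ n) =O[𝓝 0] fun x => x ^ m := by
  refine IsBigO.of_bound 1 ?_
  filter_upwards [Metric.ball_mem_nhds (0 : ℝ) one_pos] with x hx
  rw [mem_ball_zero_iff] at hx
  rw [norm_pow, norm_pow, one_mul]
  exact pow_le_pow_of_le_one (norm_nonneg x) hx.le h

theorem exp_mul_log_one_add_mul_sub_isBigO (a b : ℝ) :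
    (fun x : ℝ => Real.exp (b * Real.log (1 + a * x))
        - (1 + b * a * x + b * (b - 1) / 2 * a ^ 2 * x ^ 2)) =O[𝓝 0] fun x => x ^ 3 := by
  set u : ℝ → ℝ := fun x => b * Real.log (1 + a * x) with hu
  have hu3 : (fun x => u x - (b * a * x - b * a ^ 2 / 2 * x ^ 2)) =O[𝓝 0] fun x => x ^ 3 := by
    have h1 := ((log_one_add_mul_sub_isBigO a).const_mul_left b).trans
      (pow_isBigO_pow_nhds_zero (show 3 ≤ 4 by norm_num))
    have h2 := (isBigO_refl (fun x : ℝ => x ^ 3) (𝓝 0)).const_mul_left (b * a ^ 3 / 3)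
    refine (h1.add h2).congr_left fun x => ?_
    simp only [hu]; ring
  have hx : ∀ c : ℝ, (fun x : ℝ => c * x) =O[𝓝 0] fun x => x := fun c =>
    (isBigO_refl _ _).const_mul_left c
  have hx2 : ∀ c : ℝ, (fun x : ℝ => c * x ^ 2) =O[𝓝 0] fun x => x ^ 2 := fun c =>
    (isBigO_refl _ _).const_mul_left c
  have h32 := pow_isBigO_pow_nhds_zero (show 2 ≤ 3 by norm_num)
  have h21 : (fun x : ℝ => x ^ 2) =O[𝓝 0] fun x => x := by
    simpa using pow_isBigO_pow_nhds_zero (show 1 ≤ 2 by norm_num)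
  have hu2 : (fun x => u x - b * a * x) =O[𝓝 0] fun x => x ^ 2 :=
    ((hu3.trans h32).sub (hx2 (b * a ^ 2 / 2))).congr_left fun x => by ring
  have hu1 : u =O[𝓝 0] fun x => x :=
    ((hu2.trans h21).add (hx (b * a))).congr_left fun x => by ring
  have hu0 : Tendsto u (𝓝 0) (𝓝 0) := hu1.trans_tendsto tendsto_id
  have hexp := ((Real.exp_sub_sum_range_isBigO_pow 3).comp_tendsto hu0).trans
    (show _ =O[𝓝 0] fun x : ℝ => x ^ 3 from hu1.pow 3)
  have hsq : (fun x => (u x - b * a * x) * (u x + b * a * x)) =O[𝓝 0] fun x => x ^ 3 :=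
    (hu2.mul (hu1.add (hx (b * a)))).congr_right fun x => by ring
  refine ((hexp.add hu3).add (hsq.const_mul_left (1 / 2))).congr_left fun x => ?_
  simp only [Function.comp, Finset.sum_range_succ, Finset.sum_range_zero, Nat.factorial]
  push_cast
  ring

theorem Gamma_add_nat_succ {s : ℝ} (hs : ∀ j : ℕ, s + j ≠ 0) (k : ℕ) :
    Real.Gamma (s + k + 1) = Real.Gamma s * ∏ j ∈ range (k + 1), (s + j) := by
  induction k with
  | zero =>
    have := hs 0
    simp only [Nat.cast_zero, add_zero] at this
    simp [Real.Gamma_add_one this, mul_comm]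
  | succ k ih =>
    rw [Real.Gamma_add_one (hs (k + 1)), Finset.prod_range_succ, ← mul_assoc, ← ih]
    push_cast
    rw [add_assoc s, mul_comm]

theorem tendsto_rpow_mul_Gamma_div {α : ℝ} (hα0 : 0 < α) (hα1 : α < 1) :
    Tendsto (fun k : ℕ => (k : ℝ) ^ α * (Real.Gamma (k + 1 - α) / k.factorial)) atTop (𝓝 1) := by
  have hne : ∀ j : ℕ, -α + j ≠ 0 := by
    rintro (_ | j)
    · simp; linarith
    · have : (0 : ℝ) ≤ j := j.cast_nonneg
      push_cast
      linarith
  have hΓ : Real.Gamma (-α) ≠ 0 := Real.Gamma_ne_zero fun m h => hne m (by rw [h]; ring)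
  have h := (tendsto_const_nhds (x := Real.Gamma (-α))).div (Real.GammaSeq_tendsto_Gamma (-α)) hΓ
  rw [div_self hΓ] at h
  refine h.congr' ?_
  filter_upwards [eventually_ge_atTop 1] with k hk
  have hk0 : (0 : ℝ) < k := by exact_mod_cast hk
  have hkα : (0 : ℝ) < (k : ℝ) ^ α := Real.rpow_pos_of_pos hk0 α
  have := Gamma_add_nat_succ hne k
  rw [show -α + (k : ℝ) + 1 = k + 1 - α by ring] at this
  rw [this]
  simp only [Pi.div_apply, Real.GammaSeq, Real.rpow_neg hk0.le]
  have hf : (k.factorial : ℝ) ≠ 0 := by positivity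
  have hP : ∏ j ∈ range (k + 1), (-α + j) ≠ 0 := Finset.prod_ne_zero_iff.mpr fun j _ => hne j
  field_simp

theorem neg_inv_cube_le_of_sub_le {δ K : ℝ} (hδ : 0 < δ) (hK : 0 ≤ K) {r : ℕ → ℝ} {N : ℕ}
    (hr0 : Tendsto r atTop (𝓝 0))
    (hr : ∀ k ≥ N, r (k + 1) - r k ≤ K * ((k + δ)⁻¹) ^ 4) :
    ∀ k ≥ N, 1 ≤ k → -(8 * K * ((k + δ)⁻¹) ^ 3) ≤ r k := by
  intro k hk hk1
  have hanti : Antitone fun j : ℕ => r (j + k) + 8 * K * ((((j + k : ℕ) : ℝ) + δ)⁻¹) ^ 3 := by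
    refine antitone_nat_of_succ_le fun j => ?_
    have h := hr (j + k) (by omega)
    have hw : (1 : ℝ) ≤ ((j + k : ℕ) : ℝ) + δ := by
      have : (1 : ℝ) ≤ ((j + k : ℕ) : ℝ) := by exact_mod_cast (by omega)
      linarith
    rw [show j + 1 + k = j + k + 1 by ring, Nat.cast_succ]
    generalize ((j + k : ℕ) : ℝ) = m at *
    have hw' : m + 1 + δ = (m + δ) + 1 := by ring
    rw [hw']
    generalize m + δ = w at *
    have key : (w⁻¹) ^ 4 ≤ 8 * ((w⁻¹) ^ 3 - ((w + 1)⁻¹) ^ 3) := by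
      have h0 : 0 < w := by linarith
      have : 8 * ((w⁻¹) ^ 3 - ((w + 1)⁻¹) ^ 3) - (w⁻¹) ^ 4
          = (23 * w ^ 3 + 21 * w ^ 2 + 5 * w - 1) / (w ^ 4 * (w + 1) ^ 3) := by
        field_simp
        ring
      have h2 : 0 ≤ (23 * w ^ 3 + 21 * w ^ 2 + 5 * w - 1) / (w ^ 4 * (w + 1) ^ 3) := by
        apply div_nonneg _ (by positivity)
        have : 0 < 23 * w ^ 3 + 21 * w ^ 2 := by positivity
        linarith
      linarith
    have := mul_le_mul_of_nonneg_left key hK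
    linarith
  have hlim : Tendsto (fun j : ℕ => r (j + k) + 8 * K * ((((j + k : ℕ) : ℝ) + δ)⁻¹) ^ 3)
      atTop (𝓝 0) := by
    have h1 : Tendsto (fun j : ℕ => ((j : ℝ) + δ)⁻¹) atTop (𝓝 0) :=
      (tendsto_atTop_add_const_right _ _ tendsto_natCast_atTop_atTop).inv_tendsto_atTop
    have h2 := hr0.add ((h1.pow 3).const_mul (8 * K))
    simp only [ne_eq, OfNat.ofNat_ne_zero, not_false_eq_true, zero_pow, mul_zero, add_zero] at h2
    exact h2.comp (tendsto_add_atTop_nat k)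
  have := hanti.le_of_tendsto hlim 0
  simp only [zero_add] at this
  linarith

theorem isBigO_of_sub_isBigO {δ : ℝ} (hδ : 0 < δ) {r : ℕ → ℝ} (hr0 : Tendsto r atTop (𝓝 0))
    (hr : (fun k => r (k + 1) - r k) =O[atTop] fun k : ℕ => (((k : ℝ) + δ)⁻¹) ^ 4) :
    r =O[atTop] fun k : ℕ => (((k : ℝ) + δ)⁻¹) ^ 3 := by
  obtain ⟨K, hK, hb⟩ := hr.exists_pos
  obtain ⟨N, hN⟩ := eventually_atTop.mp hb.bound
  have hN' : ∀ k ≥ N, |r (k + 1) - r k| ≤ K * (((k : ℝ) + δ)⁻¹) ^ 4 := fun k hk => by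
    have := hN k hk
    rwa [Real.norm_eq_abs, Real.norm_of_nonneg (by positivity)] at this
  refine IsBigO.of_bound (8 * K) ?_
  filter_upwards [eventually_ge_atTop N, eventually_ge_atTop 1] with k hk hk1
  rw [Real.norm_eq_abs, Real.norm_of_nonneg (by positivity), abs_le]
  constructor
  · exact neg_inv_cube_le_of_sub_le hδ hK.le hr0 (fun j hj => (abs_le.mp (hN' j hj)).2) k hk hk1
  · have := neg_inv_cube_le_of_sub_le (r := fun j => -r j) hδ hK.le (by simpa using hr0.neg)
      (fun j hj => by linarith [(abs_le.mp (hN' j hj)).1]) k hk hk1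
    linarith

theorem log_Gamma_div_isBigO {α : ℝ} (hα0 : 0 < α) (hα1 : α < 1) :
    (fun k : ℕ => Real.log (Real.Gamma (k + 1 - α) / k.factorial)
        + α * Real.log (k + (1 - α) / 2)
        + α * (1 - α ^ 2) / 24 * (((k : ℝ) + (1 - α) / 2)⁻¹) ^ 2)
      =O[atTop] fun k : ℕ => (((k : ℝ) + (1 - α) / 2)⁻¹) ^ 3 := by
  have hδ : 0 < (1 - α) / 2 := by linarith
  have hx0 : Tendsto (fun k : ℕ => ((k : ℝ) + (1 - α) / 2)⁻¹) atTop (𝓝 0) :=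
    (tendsto_atTop_add_const_right _ _ tendsto_natCast_atTop_atTop).inv_tendsto_atTop
  have hΓpos : ∀ k : ℕ, 0 < Real.Gamma (k + 1 - α) := fun k =>
    Real.Gamma_pos_of_pos (by have : (0 : ℝ) ≤ k := k.cast_nonneg
                              linarith)
  refine isBigO_of_sub_isBigO hδ ?_ ?_
  · have h1 := (tendsto_rpow_mul_Gamma_div hα0 hα1).log one_ne_zero
    have h2 : Tendsto (fun k : ℕ => α * Real.log (1 + (1 - α) / 2 * (k : ℝ)⁻¹)) atTop (𝓝 0) := by
      have := (((tendsto_inv_atTop_zero.comp tendsto_natCast_atTop_atTop).const_mul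
        ((1 - α) / 2)).const_add (1 : ℝ)).log (by norm_num)
      simpa [Function.comp_def] using this.const_mul α
    have h3 := (hx0.pow 2).const_mul (α * (1 - α ^ 2) / 24)
    have h := (h1.add h2).add h3
    simp only [Real.log_one, ne_eq, OfNat.ofNat_ne_zero, not_false_eq_true, zero_pow, mul_zero,
      add_zero] at h
    refine h.congr' ?_
    filter_upwards [eventually_ge_atTop 1] with k hk
    have hk0 : (0 : ℝ) < k := by exact_mod_cast hk
    have hg : Real.Gamma (k + 1 - α) / k.factorial ≠ 0 :=
      (div_pos (hΓpos k) (by positivity)).ne'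
    have h4 : (k : ℝ) + (1 - α) / 2 = k * (1 + (1 - α) / 2 * (k : ℝ)⁻¹) := by field_simp
    have h5 : 1 + (1 - α) / 2 * (k : ℝ)⁻¹ ≠ 0 := by positivity
    rw [Real.log_mul (Real.rpow_pos_of_pos hk0 α).ne' hg, Real.log_rpow hk0,
      show Real.log ((k : ℝ) + (1 - α) / 2) = _ from (congrArg Real.log h4).trans
        (Real.log_mul hk0.ne' h5)]
    ring
  · refine ((log_increment_isBigO α).comp_tendsto hx0).congr_left fun k => ?_
    simp only [Function.comp]
    have hk0 : (0 : ℝ) ≤ k := k.cast_nonneg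
    have e1 : Real.Gamma (((k + 1 : ℕ) : ℝ) + 1 - α) / (k + 1).factorial
        = (k + 1 - α) / (k + 1) * (Real.Gamma (k + 1 - α) / k.factorial) := by
      have hne : (k : ℝ) + 1 - α ≠ 0 := by linarith
      rw [Nat.factorial_succ]
      push_cast
      rw [show (k : ℝ) + 1 + 1 - α = (k + 1 - α) + 1 by ring, Real.Gamma_add_one hne,
        mul_div_mul_comm]
    have e2 : ((k + 1 : ℕ) : ℝ) + (1 - α) / 2 = (k + (1 - α) / 2) + 1 := by push_cast; ring
    have hg : Real.Gamma (k + 1 - α) / k.factorial ≠ 0 :=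
      (div_pos (hΓpos k) (by positivity)).ne'
    have e3 : (k : ℝ) + 1 - α = (k + (1 - α) / 2) + (1 - α) / 2 := by ring
    have e4 : (k : ℝ) + 1 = (k + (1 - α) / 2) + (1 + α) / 2 := by ring
    rw [e1, e2, Real.log_mul (div_pos (by linarith) (by linarith)).ne' hg,
      Real.log_div (by linarith) (by linarith)]
    generalize Real.log (Real.Gamma (k + 1 - α) / k.factorial) = g
    have hw : 0 < (k : ℝ) + (1 - α) / 2 := by linarith
    rw [e3, e4]
    generalize (k : ℝ) + (1 - α) / 2 = w at *
    have l : ∀ t : ℝ, 0 ≤ t → Real.log (w + t) = Real.log w + Real.log (1 + t * w⁻¹) := by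
      intro t ht
      rw [← Real.log_mul hw.ne' (by positivity)]
      congr 1
      field_simp
    rw [l _ hδ.le, l ((1 + α) / 2) (by linarith), l 1 zero_le_one]
    have e5 : w⁻¹ ^ 2 / (1 + w⁻¹) ^ 2 = ((w + 1)⁻¹) ^ 2 := by field_simp
    rw [e5]
    ring

theorem neg_one_pow_mul_genBinom {α : ℝ} (hα1 : α < 1) (k : ℕ) :
    (-1 : ℝ) ^ k * genBinom (α - 2) k
      = (k + 1 - α) / Real.Gamma (2 - α) * (Real.Gamma (k + 1 - α) / k.factorial) := by
  have hΓ : Real.Gamma (2 - α) ≠ 0 := (Real.Gamma_pos_of_pos (by linarith)).ne'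
  induction k with
  | zero =>
    have h := Real.Gamma_add_one (show 1 - α ≠ 0 by linarith)
    rw [show 1 - α + 1 = 2 - α by ring] at h
    have h1 : 1 - α ≠ 0 := by linarith
    have h2 : Real.Gamma (1 - α) ≠ 0 := (Real.Gamma_pos_of_pos (by linarith)).ne'
    simp only [genBinom, h]
    simp
    field_simp
  | succ k ih =>
    have hk0 : (0 : ℝ) ≤ k := k.cast_nonneg
    have hne : (k : ℝ) + 1 - α ≠ 0 := by linarith
    rw [genBinom, Nat.factorial_succ, pow_succ]
    push_cast
    rw [show (k : ℝ) + 1 + 1 - α = (k + 1 - α) + 1 by ring, Real.Gamma_add_one hne]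
    calc _ = ((-1) ^ k * genBinom (α - 2) k) * ((k + 1 - α + 1) / (k + 1)) := by ring
      _ = _ := by
        rw [ih]
        have : (k.factorial : ℝ) ≠ 0 := by positivity
        field_simp

theorem scaled_error_isBigO (α : ℝ) {ι : Type*} {l : Filter ι} {x r : ι → ℝ}
    (hx : Tendsto x l (𝓝 0)) (hr : r =O[l] fun i => x i ^ 3) :
    (fun i => Real.exp ((1 - α) * Real.log (1 + 3 / 2 * x i))
        - (1 + 3 * (1 - α) / 2 * x i) * Real.exp (r i - α * (1 - α ^ 2) / 24 * x i ^ 2)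
        + α * (1 - α) * (26 - α) / 24 * x i ^ 2
          * Real.exp (-(1 + α) * Real.log (1 + (3 + α) / 2 * x i))) =O[l] fun i => x i ^ 3 := by
  have hp : ∀ {m n : ℕ}, m ≤ n → (fun i => x i ^ n) =O[l] fun i => x i ^ m := fun h =>
    (pow_isBigO_pow_nhds_zero h).comp_tendsto hx
  have hc : ∀ (c : ℝ) (m : ℕ), (fun i => c * x i ^ m) =O[l] fun i => x i ^ m := fun c m =>
    (isBigO_refl _ _).const_mul_left c
  have h1 : (fun i => Real.exp ((1 - α) * Real.log (1 + 3 / 2 * x i))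
      - (1 + (1 - α) * (3 / 2) * x i + (1 - α) * (1 - α - 1) / 2 * (3 / 2) ^ 2 * x i ^ 2))
      =O[l] fun i => x i ^ 3 :=
    (exp_mul_log_one_add_mul_sub_isBigO (3 / 2) (1 - α)).comp_tendsto hx
  set v : ι → ℝ := fun i => r i - α * (1 - α ^ 2) / 24 * x i ^ 2 with hv
  have hv2 : v =O[l] fun i => x i ^ 2 :=
    (hr.trans (hp (by norm_num))).sub (hc _ 2)
  have hv0 : Tendsto v l (𝓝 0) := hv2.trans_tendsto (by simpa using hx.pow 2)
  have h2 : (fun i => Real.exp (v i) - (1 - α * (1 - α ^ 2) / 24 * x i ^ 2))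
      =O[l] fun i => x i ^ 3 := by
    have h := ((Real.exp_sub_sum_range_isBigO_pow 2).comp_tendsto hv0).trans
      (show _ =O[l] fun i => (x i ^ 2) ^ 2 from hv2.pow 2)
    simp only [← pow_mul] at h
    refine ((h.trans (hp (by norm_num))).add hr).congr_left fun i => ?_
    simp [Finset.sum_range_succ, hv]
    ring
  have h2' : (fun i => (1 + 3 * (1 - α) / 2 * x i)
      * (Real.exp (v i) - (1 - α * (1 - α ^ 2) / 24 * x i ^ 2))) =O[l] fun i => x i ^ 3 := by
    have : Tendsto (fun i => 1 + 3 * (1 - α) / 2 * x i) l (𝓝 (1 + 3 * (1 - α) / 2 * 0)) :=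
      (hx.const_mul _).const_add 1
    simpa using (this.isBigO_one ℝ).mul h2
  have h3 : (fun i => Real.exp (-(1 + α) * Real.log (1 + (3 + α) / 2 * x i)) - 1)
      =O[l] x := by
    have h : (fun i => Real.exp (-(1 + α) * Real.log (1 + (3 + α) / 2 * x i))
        - (1 + -(1 + α) * ((3 + α) / 2) * x i
          + -(1 + α) * (-(1 + α) - 1) / 2 * ((3 + α) / 2) ^ 2 * x i ^ 2))
        =O[l] fun i => x i ^ 3 :=
      (exp_mul_log_one_add_mul_sub_isBigO ((3 + α) / 2) (-(1 + α))).comp_tendsto hx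
    have h' := ((h.trans (hp (show 1 ≤ 3 by norm_num))).add
      (hc (-(1 + α) * ((3 + α) / 2)) 1)).add
      ((hc (-(1 + α) * (-(1 + α) - 1) / 2 * ((3 + α) / 2) ^ 2) 2).trans
        (hp (show 1 ≤ 2 by norm_num)))
    simp only [pow_one] at h'
    refine h'.congr_left fun i => ?_
    ring
  have h3' : (fun i => α * (1 - α) * (26 - α) / 24 * x i ^ 2
      * (Real.exp (-(1 + α) * Real.log (1 + (3 + α) / 2 * x i)) - 1)) =O[l] fun i => x i ^ 3 :=
    ((hc (α * (1 - α) * (26 - α) / 24) 2).mul h3).congr_right fun i => by ring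
  refine (((h1.sub h2').add h3').add (hc (3 * (1 - α) / 2 * (α * (1 - α ^ 2) / 24)) 3)).congr_left
    fun i => ?_
  ring

theorem weight_error_eq {α : ℝ} (hα0 : 0 < α) (hα1 : α < 1) (k : ℕ) {w r : ℝ}
    (hw : w = k + (1 - α) / 2)
    (hr : r = Real.log (Real.Gamma (k + 1 - α) / k.factorial) + α * Real.log w
      + α * (1 - α ^ 2) / 24 * w⁻¹ ^ 2) :
    (((k : ℝ) + 2) - 2 * α) / (1 + α - ((k : ℝ) + 2)) * ((-1 : ℝ) ^ k * genBinom (α - 2) k)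
        + (((k : ℝ) + 2) - α / 2) ^ (1 - α) / Real.Gamma (2 - α)
        - (26 - α) / (24 * Real.Gamma (-α) * ((k : ℝ) + 2) ^ (1 + α))
      = w ^ (1 - α) / Real.Gamma (2 - α)
        * (Real.exp ((1 - α) * Real.log (1 + 3 / 2 * w⁻¹))
          - (1 + 3 * (1 - α) / 2 * w⁻¹) * Real.exp (r - α * (1 - α ^ 2) / 24 * w⁻¹ ^ 2)
          + α * (1 - α) * (26 - α) / 24 * w⁻¹ ^ 2
            * Real.exp (-(1 + α) * Real.log (1 + (3 + α) / 2 * w⁻¹))) := by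
  have hk0 : (0 : ℝ) ≤ k := k.cast_nonneg
  have hw0 : 0 < w := by linarith
  have hg : 0 < Real.Gamma (k + 1 - α) / k.factorial :=
    div_pos (Real.Gamma_pos_of_pos (by linarith)) (by positivity)
  have hΓ2 : Real.Gamma (2 - α) = (1 - α) * (-α * Real.Gamma (-α)) := by
    rw [← Real.Gamma_add_one (by linarith : -α ≠ 0), show -α + 1 = 1 - α by ring,
      ← Real.Gamma_add_one (by linarith : 1 - α ≠ 0)]
    congr 1
    ring
  have hΓpos : 0 < Real.Gamma (2 - α) := Real.Gamma_pos_of_pos (by linarith)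
  have l : ∀ t : ℝ, 0 ≤ t → ∀ b : ℝ,
      (w + t) ^ b = w ^ b * Real.exp (b * Real.log (1 + t * w⁻¹)) := by
    intro t ht b
    have h1 : 0 < 1 + t * w⁻¹ := by positivity
    rw [show w + t = w * (1 + t * w⁻¹) by field_simp, Real.mul_rpow hw0.le h1.le,
      Real.rpow_def_of_pos h1, mul_comm b]
  have eg : Real.Gamma (k + 1 - α) / k.factorial
      = Real.exp (r - α * (1 - α ^ 2) / 24 * w⁻¹ ^ 2) * w ^ (-α) := by
    rw [Real.rpow_def_of_pos hw0, ← Real.exp_add, hr, ← Real.exp_log hg, Real.log_exp]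
    congr 1
    ring
  have e1 : w ^ (-α) = w ^ (1 - α) * w⁻¹ := by
    rw [← Real.rpow_neg_one w, ← Real.rpow_add hw0]
    congr 1
    ring
  have e2 : (((k : ℝ) + 2) ^ (1 + α))⁻¹ = w ^ (1 - α) * w⁻¹ ^ 2
      * Real.exp (-(1 + α) * Real.log (1 + (3 + α) / 2 * w⁻¹)) := by
    rw [← Real.rpow_neg (by linarith), show (k : ℝ) + 2 = w + (3 + α) / 2 by rw [hw]; ring,
      l _ (by linarith)]
    congr 1
    rw [← Real.rpow_natCast, ← Real.rpow_neg_one w, ← Real.rpow_mul hw0.le, ← Real.rpow_add hw0]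
    congr 1
    push_cast
    ring
  have e3 : ((k : ℝ) + 2 - 2 * α) / (1 + α - ((k : ℝ) + 2))
      * ((k + 1 - α) / Real.Gamma (2 - α) * (Real.Gamma (k + 1 - α) / k.factorial))
      = -((1 + 3 * (1 - α) / 2 * w⁻¹) * w) * (Real.Gamma (k + 1 - α) / k.factorial)
        / Real.Gamma (2 - α) := by
    have h1 : 1 + α - ((k : ℝ) + 2) = -(k + 1 - α) := by ring
    have h2 : (k : ℝ) + 1 - α ≠ 0 := by linarith
    have h3 : (1 + 3 * (1 - α) / 2 * w⁻¹) * w = k + 2 - 2 * α := by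
      rw [add_mul, one_mul, mul_assoc, inv_mul_cancel₀ hw0.ne', hw]; ring
    rw [h1, h3]
    field_simp
  have e4 : (26 - α) / (24 * Real.Gamma (-α) * ((k : ℝ) + 2) ^ (1 + α))
      = -(α * (1 - α) * (26 - α) / 24 / Real.Gamma (2 - α)) * (((k : ℝ) + 2) ^ (1 + α))⁻¹ := by
    have hne : Real.Gamma (-α) ≠ 0 := by
      rintro h
      rw [h] at hΓ2
      simp at hΓ2
      linarith
    have : 1 - α ≠ 0 := by linarith
    rw [hΓ2]
    field_simp
  rw [neg_one_pow_mul_genBinom hα1, e3, eg, e4, e2, e1,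
    show (k : ℝ) + 2 - α / 2 = w + 3 / 2 by rw [hw]; ring, l _ (by norm_num)]
  field_simp
  ring

theorem stmt13 (α : ℝ) (hα0 : 0 < α) (hα1 : α < 1) :
    ∃ C > (0:ℝ), ∀ n : ℕ, 2 ≤ n →
      abs ((((n : ℝ) - 2 * α) / (1 + α - (n : ℝ))) *
            ((-1 : ℝ) ^ (n - 2) * genBinom (α - 2) (n - 2)) +
          ((n : ℝ) - α / 2) ^ (1 - α) / Real.Gamma (2 - α) -
          (26 - α) / (24 * Real.Gamma (-α) * (n : ℝ) ^ (1 + α))) ≤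
        C / (n : ℝ) ^ (2 + α) := by
  have hx0 : Tendsto (fun k : ℕ => ((k : ℝ) + (1 - α) / 2)⁻¹) atTop (𝓝 0) :=
    (tendsto_atTop_add_const_right _ _ tendsto_natCast_atTop_atTop).inv_tendsto_atTop
  have hE := scaled_error_isBigO α hx0 (log_Gamma_div_isBigO hα0 hα1)
  have hpre : (fun k : ℕ => ((k : ℝ) + (1 - α) / 2) ^ (1 - α) / Real.Gamma (2 - α))
      =O[atTop] fun k : ℕ => ((k : ℝ) + (1 - α) / 2) ^ (1 - α) := by
    simp only [div_eq_inv_mul _ (Real.Gamma (2 - α))]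
    exact (isBigO_refl _ _).const_mul_left _
  have hf := (hpre.mul hE).congr_left fun k => (weight_error_eq hα0 hα1 k rfl rfl).symm
  have hg : (fun k : ℕ => ((k : ℝ) + (1 - α) / 2) ^ (1 - α) * (((k : ℝ) + (1 - α) / 2)⁻¹) ^ 3)
      =O[atTop] fun k : ℕ => (((k : ℝ) + 2) ^ (2 + α))⁻¹ := by
    refine IsBigO.of_bound (3 ^ (2 + α)) ?_
    filter_upwards [eventually_ge_atTop 1] with k hk
    have hk1 : (1 : ℝ) ≤ k := by exact_mod_cast hk
    have hw0 : 0 < (k : ℝ) + (1 - α) / 2 := by linarith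
    have hle : (k : ℝ) + 2 ≤ 3 * (k + (1 - α) / 2) := by linarith
    rw [Real.norm_of_nonneg (by positivity), Real.norm_of_nonneg (by positivity)]
    generalize (k : ℝ) + (1 - α) / 2 = w at *
    have e : w ^ (1 - α) * w⁻¹ ^ 3 = (w ^ (2 + α))⁻¹ := by
      rw [← Real.rpow_natCast, ← Real.rpow_neg_one w, ← Real.rpow_mul hw0.le,
        ← Real.rpow_add hw0, ← Real.rpow_neg hw0.le]
      congr 1
      push_cast
      ring
    have h1 : ((k : ℝ) + 2) ^ (2 + α) ≤ 3 ^ (2 + α) * w ^ (2 + α) := by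
      rw [← Real.mul_rpow (by norm_num) hw0.le]
      exact Real.rpow_le_rpow (by linarith) hle (by linarith)
    have hwp : 0 < w ^ (2 + α) := Real.rpow_pos_of_pos hw0 _
    have hkp : 0 < ((k : ℝ) + 2) ^ (2 + α) := by positivity
    rw [e, inv_le_iff_one_le_mul₀ hwp, mul_assoc, mul_comm, mul_assoc, inv_mul_eq_div,
      one_le_div hkp, mul_comm]
    exact h1
  obtain ⟨C, hC, hb⟩ := bound_of_isBigO_nat_atTop (hf.trans hg)
  refine ⟨C, hC, fun n hn => ?_⟩
  obtain ⟨k, rfl⟩ := Nat.exists_eq_add_of_le' hn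
  have hkp : 0 < ((k : ℝ) + 2) ^ (2 + α) := by positivity
  have := hb (x := k) (inv_pos.mpr hkp).ne'
  rw [Real.norm_eq_abs, Real.norm_of_nonneg (inv_pos.mpr hkp).le] at this
  simpa [div_eq_mul_inv] using this
end

section
/- Let 0 < α < 1 and for integers n ≥ 2 define γ_n^{(α)} = (−1)^{n−2} C(α−2, n−2) − (n − α/2)^{1−α}/Γ(2−α). There exists a constant C > 0 such that for every integer n ≥ 2, |γ_n^{(α)} + 1/(Γ(1−α) n^{α}) − (13α + 10)/(24 Γ(−α) n^{1+α})| ≤ C / n^{2+α}. -/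
open Finset

lemma abs_log_one_add_sub_le {x : ℝ} (hx : |x| ≤ 1 / 2) :
    |Real.log (1 + x) - (x - x ^ 2 / 2 + x ^ 3 / 3)| ≤ 2 * x ^ 4 := by
  have h := Real.abs_log_sub_add_sum_range_le (x := -x) (by rw [abs_neg]; linarith) 3
  norm_num [Finset.sum_range_succ] at h
  rw [(by ring : x - x ^ 2 / 2 + x ^ 3 / 3 = -(-x + x ^ 2 / 2 + (-x) ^ 3 / 3)), sub_neg_eq_add,
    add_comm]
  refine h.trans ?_
  rw [(show Even 4 by decide).pow_abs, div_le_iff₀ (by linarith)]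
  nlinarith [pow_nonneg (sq_nonneg x) 2]

lemma abs_sub_le_of_tendsto_of_abs_succ_sub_le {a : ℕ → ℝ} {l C : ℝ} (hC : 0 ≤ C)
    (hstep : ∀ k, |a (k + 1) - a k| ≤ C / ((k : ℝ) + 2) ^ 4)
    (hlim : Filter.Tendsto a Filter.atTop (nhds l)) (k : ℕ) :
    |a k - l| ≤ 2 * C / ((k : ℝ) + 2) ^ 3 := by
  set v : ℕ → ℝ := fun k => 2 * C / ((k : ℝ) + 2) ^ 3 with hv
  have hv0 : Filter.Tendsto v Filter.atTop (nhds 0) := by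
    refine Filter.Tendsto.div_atTop tendsto_const_nhds ?_
    exact (Filter.tendsto_pow_atTop (by norm_num)).comp
      (Filter.tendsto_atTop_add_const_right _ _ tendsto_natCast_atTop_atTop)
  have hvd (k : ℕ) : C / ((k : ℝ) + 2) ^ 4 ≤ v k - v (k + 1) := by
    have hk : (0 : ℝ) ≤ k := k.cast_nonneg
    have key : v k - v (k + 1) - C / ((k : ℝ) + 2) ^ 4 = C * (5 * ((k : ℝ) + 2) ^ 3 + 3 * ((k : ℝ) + 2) ^ 2
        - ((k : ℝ) + 2) - 1) / (((k : ℝ) + 2) ^ 4 * ((k : ℝ) + 3) ^ 3) := by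
      simp only [hv]
      push_cast
      rw [(by ring : (k : ℝ) + 1 + 2 = k + 3)]
      field_simp
      ring
    have : 0 ≤ v k - v (k + 1) - C / ((k : ℝ) + 2) ^ 4 := by
      rw [key]
      refine div_nonneg (mul_nonneg hC ?_) (by positivity)
      nlinarith [pow_nonneg hk 3, pow_nonneg hk 2]
    linarith
  have hmono : Monotone fun k => a k - v k := monotone_nat_of_le_succ fun k => by
    have := (abs_le.1 ((hstep k).trans (hvd k))).1
    linarith
  have hanti : Antitone fun k => a k + v k := antitone_nat_of_succ_le fun k => by
    have := (abs_le.1 ((hstep k).trans (hvd k))).2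
    linarith
  have h1 := hmono.ge_of_tendsto (by simpa using hlim.sub hv0) k
  have h2 := hanti.le_of_tendsto (by simpa using hlim.add hv0) k
  rw [abs_le]
  constructor <;> simp only [hv] at h1 h2 <;> linarith

open Asymptotics Filter in
lemma isBigO_exp_sub_quadratic {ι : Type*} {l : Filter ι} {e t : ι → ℝ} {a b : ℝ}
    (ht : Tendsto t l (nhds 0))
    (he : (fun i => e i - (a * t i + b * t i ^ 2)) =O[l] fun i => t i ^ 3) :
    (fun i => Real.exp (e i) - (1 + a * t i + (b + a ^ 2 / 2) * t i ^ 2)) =O[l]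
      fun i => t i ^ 3 := by
  have hpow {m k : ℕ} (h : k ≤ m) : (fun i => t i ^ m) =O[l] fun i => t i ^ k := by
    obtain ⟨j, rfl⟩ := Nat.exists_eq_add_of_le h
    have h1 : (fun i => t i ^ j) =O[l] fun _ => (1 : ℝ) := (ht.pow j).isBigO_one ℝ
    simpa [pow_add] using (isBigO_refl (fun i => t i ^ k) l).mul h1
  have hq : (fun i => e i - a * t i) =O[l] fun i => t i ^ 2 := by
    refine ((he.trans (hpow (by norm_num : 2 ≤ 3))).add
      ((isBigO_refl (fun i => t i ^ 2) l).const_mul_left b)).congr_left fun i => by ring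
  have he1 : e =O[l] t := by
    have := hpow (by norm_num : 1 ≤ 2)
    simp only [pow_one] at this
    exact ((hq.trans this).add ((isBigO_refl t l).const_mul_left a)).congr_left fun i => by ring
  have he0 : Tendsto e l (nhds 0) := he1.trans_tendsto ht
  have hexp := ((Real.exp_sub_sum_range_isBigO_pow 3).comp_tendsto he0).trans (he1.pow 3)
  have hsq : (fun i => (e i - a * t i) * (e i + a * t i)) =O[l] fun i => t i ^ 3 :=
    (hq.mul (he1.add ((isBigO_refl t l).const_mul_left a))).congr_right fun i => by ring
  refine ((hexp.add he).add (hsq.const_mul_left (1 / 2))).congr_left fun i => ?_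
  simp [Finset.sum_range_succ]
  ring

lemma neg_one_pow_mul_genBinom_succ (x : ℝ) (k : ℕ) :
    (-1 : ℝ) ^ (k + 1) * genBinom (-x) (k + 1) =
      (-1 : ℝ) ^ k * genBinom (-x) k * ((x + k) / (k + 1)) := by
  rw [genBinom, pow_succ]
  ring

lemma neg_one_pow_mul_genBinom_pos {x : ℝ} (hx : 0 < x) (k : ℕ) :
    0 < (-1 : ℝ) ^ k * genBinom (-x) k := by
  induction k with
  | zero => simp [genBinom]
  | succ k ih =>
    rw [neg_one_pow_mul_genBinom_succ]
    positivity

lemma neg_one_pow_mul_genBinom_eq_prod (x : ℝ) (k : ℕ) :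
    (-1 : ℝ) ^ k * genBinom (-x) k = (∏ j ∈ Finset.range k, (x + j)) / k.factorial := by
  induction k with
  | zero => simp [genBinom]
  | succ k ih =>
    rw [neg_one_pow_mul_genBinom_succ, ih, Finset.prod_range_succ, Nat.factorial_succ]
    push_cast
    have : (k.factorial : ℝ) ≠ 0 := by positivity
    field_simp

open Filter in
lemma tendsto_neg_one_pow_mul_genBinom_div_rpow {x : ℝ} (hx : 0 < x) :
    Tendsto (fun k : ℕ => (-1 : ℝ) ^ k * genBinom (-x) k / ((k : ℝ) + 2) ^ (x - 1)) atTop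
      (nhds (1 / Real.Gamma x)) := by
  have h1 (c : ℝ) : Tendsto (fun k : ℕ => (k : ℝ) / (k + c)) atTop (nhds 1) :=
    tendsto_natCast_div_add_atTop c
  have h2 := ((h1 2).rpow_const (p := x - 1) (Or.inl one_ne_zero)).mul (h1 x)
  have h3 := h2.div (Real.GammaSeq_tendsto_Gamma x) (Real.Gamma_pos_of_pos hx).ne'
  rw [Real.one_rpow, one_mul] at h3
  refine h3.congr' ?_
  filter_upwards [eventually_ge_atTop 1] with k hk
  have hk0 : (0 : ℝ) < k := by exact_mod_cast hk
  have hprod : 0 < ∏ j ∈ Finset.range k, (x + j) := Finset.prod_pos fun j _ => by positivity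
  simp only [Pi.div_apply]
  rw [neg_one_pow_mul_genBinom_eq_prod, Real.GammaSeq, Finset.prod_range_succ,
    Real.div_rpow hk0.le (by positivity), Real.rpow_sub_one hk0.ne']
  have : (k.factorial : ℝ) ≠ 0 := by positivity
  have : (k : ℝ) ^ x ≠ 0 := by positivity
  have : ((k : ℝ) + 2) ^ (x - 1) ≠ 0 := by positivity
  have : x + k ≠ 0 := by positivity
  have : (k : ℝ) + x ≠ 0 := by positivity
  field_simp
  ring

lemma exists_abs_log_step_le (α : ℝ) (hα0 : 0 < α) (hα1 : α < 1) :
    ∃ C : ℝ, 0 ≤ C ∧ ∀ t : ℝ, 0 < t → t ≤ 1 / 2 →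
      |Real.log (1 - α * t) - Real.log (1 - t) - (1 - α) * Real.log (1 + t)
        - (-((1 - α) * (2 + α) / 2) * (t / (1 + t) - t)
          + (-((1 - α) * (2 + α) / 4) - α * (1 - α ^ 2) / 6) * ((t / (1 + t)) ^ 2 - t ^ 2))|
        ≤ C * t ^ 4 := by
  set d₁ : ℝ := -((1 - α) * (2 + α) / 2) with hd₁
  set d₂ : ℝ := -((1 - α) * (2 + α) / 4) - α * (1 - α ^ 2) / 6 with hd₂
  refine ⟨6 + |d₁| + 4 * |d₂|, by positivity, fun t ht0 ht => ?_⟩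
  have hαt : 0 < α * t := by positivity
  have hαt' : α * t ≤ t := by nlinarith
  have h1 := abs_log_one_add_sub_le (x := -(α * t)) (by rw [abs_neg, abs_of_pos hαt]; linarith)
  have h2 := abs_log_one_add_sub_le (x := -t) (by rw [abs_neg, abs_of_pos ht0]; linarith)
  have h3 := abs_log_one_add_sub_le (x := t) (by rw [abs_of_pos ht0]; linarith)
  rw [← sub_eq_add_neg] at h1 h2
  set A := Real.log (1 - α * t) - (-(α * t) - (-(α * t)) ^ 2 / 2 + (-(α * t)) ^ 3 / 3) with hA
  set B := Real.log (1 - t) - _ with hB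
  set D := Real.log (1 + t) - _ with hD
  have ht4 : (0 : ℝ) < t ^ 4 := by positivity
  have h1' : |A| ≤ 2 * t ^ 4 := by
    rw [Even.neg_pow (by decide : Even 4)] at h1
    exact h1.trans (by gcongr)
  have h2' : |B| ≤ 2 * t ^ 4 := by rwa [Even.neg_pow (by decide : Even 4)] at h2
  have h3' : |(1 - α) * D| ≤ 2 * t ^ 4 := by
    rw [abs_mul, abs_of_pos (by linarith)]
    nlinarith [abs_nonneg D]
  have h4 : |d₁ * (t ^ 4 / (1 + t))| ≤ |d₁| * t ^ 4 := by
    rw [abs_mul, abs_of_pos (by positivity : 0 < t ^ 4 / (1 + t))]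
    gcongr
    exact div_le_self ht4.le (by linarith)
  have h5 : |d₂ * (t ^ 4 * ((3 + 2 * t) / (1 + t) ^ 2))| ≤ |d₂| * (t ^ 4 * 4) := by
    rw [abs_mul, abs_of_pos (by positivity : 0 < t ^ 4 * ((3 + 2 * t) / (1 + t) ^ 2))]
    gcongr
    rw [div_le_iff₀ (by positivity)]
    nlinarith
  have key : Real.log (1 - α * t) - Real.log (1 - t) - (1 - α) * Real.log (1 + t)
        - (d₁ * (t / (1 + t) - t) + d₂ * ((t / (1 + t)) ^ 2 - t ^ 2)) =
      A - B - (1 - α) * D + d₁ * (t ^ 4 / (1 + t))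
        - d₂ * (t ^ 4 * ((3 + 2 * t) / (1 + t) ^ 2)) := by
    have e1 : t / (1 + t) - t = -t ^ 2 + t ^ 3 - t ^ 4 / (1 + t) := by
      field_simp
      ring
    have e2 : (t / (1 + t)) ^ 2 - t ^ 2 = -2 * t ^ 3 + t ^ 4 * ((3 + 2 * t) / (1 + t) ^ 2) := by
      field_simp
      ring
    rw [e1, e2, hA, hB, hD, hd₁, hd₂]
    ring
  rw [key]
  rw [abs_le] at *
  constructor <;> linarith [h1'.1, h1'.2]

lemma exists_abs_log_genBinom_le (α : ℝ) (hα0 : 0 < α) (hα1 : α < 1) :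
    ∃ C : ℝ, ∀ k : ℕ,
      |Real.log (Real.Gamma (2 - α) *
            ((-1 : ℝ) ^ k * genBinom (-(2 - α)) k / ((k : ℝ) + 2) ^ (1 - α)))
        - (-((1 - α) * (2 + α) / 2) * ((k : ℝ) + 2)⁻¹
          + (-((1 - α) * (2 + α) / 4) - α * (1 - α ^ 2) / 6) * ((k : ℝ) + 2)⁻¹ ^ 2)|
        ≤ C * ((k : ℝ) + 2)⁻¹ ^ 3 := by
  obtain ⟨C, hC, hstep⟩ := exists_abs_log_step_le α hα0 hα1
  set d₁ : ℝ := -((1 - α) * (2 + α) / 2)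
  set d₂ : ℝ := -((1 - α) * (2 + α) / 4) - α * (1 - α ^ 2) / 6
  have hx : 0 < 2 - α := by linarith
  have hΓ := Real.Gamma_pos_of_pos hx
  have hinv : Filter.Tendsto (fun k : ℕ => ((k : ℝ) + 2)⁻¹) Filter.atTop (nhds 0) :=
    Filter.Tendsto.inv_tendsto_atTop
      (Filter.tendsto_atTop_add_const_right _ _ tendsto_natCast_atTop_atTop)
  have hlim := tendsto_neg_one_pow_mul_genBinom_div_rpow hx
  rw [(by ring : 2 - α - 1 = 1 - α)] at hlim
  have hlim1 := hlim.const_mul (Real.Gamma (2 - α))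
  rw [mul_one_div_cancel hΓ.ne'] at hlim1
  have hlim2 := (hlim1.log one_ne_zero).sub
    ((hinv.const_mul d₁).add ((hinv.pow 2).const_mul d₂))
  norm_num only [Real.log_one, mul_zero, add_zero, sub_zero] at hlim2
  refine ⟨2 * C, fun k => ?_⟩
  have := abs_sub_le_of_tendsto_of_abs_succ_sub_le hC (fun k => ?_) hlim2 k
  · rwa [sub_zero, div_eq_mul_inv (2 * C), ← inv_pow] at this
  have hk : (0 : ℝ) ≤ k := k.cast_nonneg
  have hs := hstep ((k : ℝ) + 2)⁻¹ (by positivity) (by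
    rw [one_div]
    exact inv_anti₀ (by norm_num) (by linarith))
  rw [div_eq_mul_inv C, ← inv_pow]
  refine le_of_eq_of_le (congrArg _ ?_) hs
  have hg := neg_one_pow_mul_genBinom_pos hx k
  have e1 : ((k : ℝ) + 2)⁻¹ / (1 + ((k : ℝ) + 2)⁻¹) = ((k + 1 : ℕ) + 2 : ℝ)⁻¹ := by
    push_cast
    field_simp
    ring
  have e2 : 1 - α * ((k : ℝ) + 2)⁻¹ = (2 - α + k) / (k + 2) := by
    field_simp
    ring
  have e3 : 1 - ((k : ℝ) + 2)⁻¹ = (k + 1) / (k + 2) := by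
    field_simp
    ring
  have e4 : 1 + ((k : ℝ) + 2)⁻¹ = ((k + 1 : ℕ) + 2) / (k + 2) := by
    push_cast
    field_simp
    ring
  have p1 : (0 : ℝ) < (k + 1 : ℕ) + 2 := by positivity
  have p2 : (0 : ℝ) < 2 - α + k := by positivity
  have p3 : (0 : ℝ) < (k : ℝ) + 2 := by positivity
  have p4 : (0 : ℝ) < (k : ℝ) + 1 := by positivity
  rw [e1, e2, e3, e4, neg_one_pow_mul_genBinom_succ]
  set g := (-1 : ℝ) ^ k * genBinom (-(2 - α)) k
  rw [Real.log_mul hΓ.ne' (by positivity), Real.log_mul hΓ.ne' (by positivity),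
    Real.log_div (by positivity) (by positivity), Real.log_div (by positivity) (by positivity),
    Real.log_div (by positivity) (by positivity), Real.log_div (by positivity) (by positivity),
    Real.log_div (by positivity) (by positivity), Real.log_mul (by positivity) (by positivity),
    Real.log_div (by positivity) (by positivity), Real.log_rpow p1, Real.log_rpow p3]
  ring

open Asymptotics Filter in
lemma isBigO_genBinom_sub_rpow (α : ℝ) (hα0 : 0 < α) (hα1 : α < 1) :
    (fun k : ℕ => Real.Gamma (2 - α) *
          ((-1 : ℝ) ^ k * genBinom (-(2 - α)) k / ((k : ℝ) + 2) ^ (1 - α))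
        - (1 - α / 2 * ((k : ℝ) + 2)⁻¹) ^ (1 - α)
        + (1 - α) * ((k : ℝ) + 2)⁻¹
        + α * (1 - α) * (13 * α + 10) / 24 * ((k : ℝ) + 2)⁻¹ ^ 2) =O[atTop]
      fun k : ℕ => ((k : ℝ) + 2)⁻¹ ^ 3 := by
  have hinv : Tendsto (fun k : ℕ => ((k : ℝ) + 2)⁻¹) atTop (nhds 0) :=
    Tendsto.inv_tendsto_atTop (tendsto_atTop_add_const_right _ _ tendsto_natCast_atTop_atTop)
  have hx : 0 < 2 - α := by linarith
  have hΓ := Real.Gamma_pos_of_pos hx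
  obtain ⟨C, hC⟩ := exists_abs_log_genBinom_le α hα0 hα1
  have h1 := isBigO_exp_sub_quadratic hinv (IsBigO.of_bound C (Eventually.of_forall fun k => by
    rw [Real.norm_eq_abs, Real.norm_of_nonneg (by positivity)]
    exact hC k))
  have h2 := isBigO_exp_sub_quadratic (l := atTop) (t := fun k : ℕ => ((k : ℝ) + 2)⁻¹)
    (e := fun k : ℕ => (1 - α) * Real.log (1 - α / 2 * ((k : ℝ) + 2)⁻¹))
    (a := -(α * (1 - α) / 2)) (b := -(α ^ 2 * (1 - α) / 8)) hinv
    (IsBigO.of_bound 1 (Eventually.of_forall fun k => by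
      have hk : (0 : ℝ) ≤ k := k.cast_nonneg
      rw [Real.norm_eq_abs, Real.norm_of_nonneg (by positivity)]
      have ht0 : 0 < ((k : ℝ) + 2)⁻¹ := by positivity
      have ht : ((k : ℝ) + 2)⁻¹ ≤ 1 / 2 := by
        rw [one_div]
        exact inv_anti₀ (by norm_num) (by linarith)
      set t := ((k : ℝ) + 2)⁻¹
      have hy0 : 0 < α / 2 * t := by positivity
      have hy : α / 2 * t ≤ t / 2 := by nlinarith
      have h := abs_log_one_add_sub_le (x := -(α / 2 * t))
        (by rw [abs_neg, abs_of_pos hy0]; linarith)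
      rw [← sub_eq_add_neg, Even.neg_pow (by decide : Even 4)] at h
      have hy3 := pow_le_pow_left₀ hy0.le hy 3
      have hy4 : (α / 2 * t) ^ 4 ≤ (t / 2) ^ 3 * (1 / 4) := by
        rw [pow_succ]
        exact mul_le_mul hy3 (by linarith) hy0.le (by positivity)
      have ht3 : 0 < t ^ 3 := by positivity
      have hy3' : 0 < (α / 2 * t) ^ 3 := by positivity
      have h' : |Real.log (1 - α / 2 * t) + α / 2 * t + (α / 2 * t) ^ 2 / 2| ≤ 1 * t ^ 3 := by
        rw [abs_le] at h ⊢
        constructor <;> nlinarith [h.1, h.2]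
      rw [(by ring : (1 - α) * Real.log (1 - α / 2 * t) -
        (-(α * (1 - α) / 2) * t + -(α ^ 2 * (1 - α) / 8) * t ^ 2) =
        (1 - α) * (Real.log (1 - α / 2 * t) + α / 2 * t + (α / 2 * t) ^ 2 / 2)), abs_mul,
        abs_of_pos (by linarith : 0 < 1 - α)]
      nlinarith [abs_nonneg (Real.log (1 - α / 2 * t) + α / 2 * t + (α / 2 * t) ^ 2 / 2)]))
  refine (h1.sub h2).congr_left fun k => ?_
  have hk : (0 : ℝ) ≤ k := k.cast_nonneg
  have hg := neg_one_pow_mul_genBinom_pos hx k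
  have hpos : 0 < 1 - α / 2 * ((k : ℝ) + 2)⁻¹ := by
    have : ((k : ℝ) + 2)⁻¹ ≤ 1 := inv_le_one_of_one_le₀ (by linarith)
    nlinarith
  rw [Real.exp_log (by positivity), Real.rpow_def_of_pos hpos, mul_comm (Real.log _)]
  ring

theorem stmt14 (α : ℝ) (hα0 : 0 < α) (hα1 : α < 1) :
    ∃ C > (0:ℝ), ∀ n : ℕ, 2 ≤ n →
      |((-1 : ℝ) ^ (n - 2) * genBinom (α - 2) (n - 2) -
            ((n : ℝ) - α / 2) ^ (1 - α) / Real.Gamma (2 - α)) +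
          1 / (Real.Gamma (1 - α) * (n : ℝ) ^ α) -
          (13 * α + 10) / (24 * Real.Gamma (-α) * (n : ℝ) ^ (1 + α))| ≤
        C / (n : ℝ) ^ (2 + α) := by
  have hΓ := Real.Gamma_pos_of_pos (by linarith : 0 < 2 - α)
  have hΓ1 : Real.Gamma (2 - α) = (1 - α) * Real.Gamma (1 - α) := by
    rw [← Real.Gamma_add_one (by linarith)]
    ring_nf
  have hΓ0 : Real.Gamma (1 - α) = -α * Real.Gamma (-α) := by
    rw [← Real.Gamma_add_one (by linarith)]
    ring_nf
  obtain ⟨C, hC0, hC⟩ := Asymptotics.bound_of_isBigO_nat_atTop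
    (isBigO_genBinom_sub_rpow α hα0 hα1)
  refine ⟨C / Real.Gamma (2 - α), by positivity, fun n hn => ?_⟩
  obtain ⟨k, rfl⟩ := Nat.exists_eq_add_of_le' hn
  have h := @hC k (by positivity)
  rw [Real.norm_eq_abs, Real.norm_of_nonneg (by positivity)] at h
  have hN : (0 : ℝ) < (k : ℝ) + 2 := by positivity
  have hN2 : (2 : ℝ) ≤ (k : ℝ) + 2 := by linarith [(k.cast_nonneg : (0 : ℝ) ≤ k)]
  push_cast
  rw [(by ring : α - 2 = -(2 - α))]
  set g := (-1 : ℝ) ^ k * genBinom (-(2 - α)) k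
  set N : ℝ := (k : ℝ) + 2
  have hpow : (N - α / 2) ^ (1 - α) = N ^ (1 - α) * (1 - α / 2 * N⁻¹) ^ (1 - α) := by
    have : 0 ≤ 1 - α / 2 * N⁻¹ := by
      have : N⁻¹ ≤ 1 := inv_le_one_of_one_le₀ (by linarith)
      have : 0 < N⁻¹ := by positivity
      nlinarith
    rw [← Real.mul_rpow hN.le this]
    congr 1
    field_simp
  have hNα : 0 < N ^ α := by positivity
  have p1 : N ^ (1 - α) = N / N ^ α := by rw [Real.rpow_sub hN, Real.rpow_one]
  have p2 : N ^ (1 + α) = N * N ^ α := by rw [Real.rpow_add hN, Real.rpow_one]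
  have p3 : N ^ (2 + α) = N ^ 2 * N ^ α := by rw [Real.rpow_add hN, Real.rpow_two]
  have hα1' : 1 - α ≠ 0 := by linarith
  have hG : Real.Gamma (-α) ≠ 0 := by
    intro h0
    rw [hΓ1, hΓ0, h0] at hΓ
    simp at hΓ
  have key : g - (N - α / 2) ^ (1 - α) / Real.Gamma (2 - α) + 1 / (Real.Gamma (1 - α) * N ^ α) -
      (13 * α + 10) / (24 * Real.Gamma (-α) * N ^ (1 + α)) =
      N ^ (1 - α) / Real.Gamma (2 - α) * (Real.Gamma (2 - α) * (g / N ^ (1 - α))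
        - (1 - α / 2 * N⁻¹) ^ (1 - α) + (1 - α) * N⁻¹
        + α * (1 - α) * (13 * α + 10) / 24 * N⁻¹ ^ 2) := by
    rw [hpow]
    generalize (1 - α / 2 * N⁻¹) ^ (1 - α) = Y
    rw [p1, p2, hΓ1, hΓ0]
    field_simp
    ring
  rw [key, abs_mul, abs_of_pos (by positivity)]
  refine (mul_le_mul_of_nonneg_left h (by positivity)).trans_eq ?_
  rw [p1, p3]
  field_simp
end
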